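/- The Manakov functions (5.2) are first integrals of the Euler equation (5.3): Let n ∈ ℕ, a, b : Fin n → ℝ with a injective, and A = diag(a) ∈ Mₙ(ℝ). Suppose x : ℝ → Mₙ(ℝ) is differentiable, x(t) is skew-symmetric for every t, and x′(t) = ⁅x(t), ω(t)⁆ for all t, where ω(t) ∈ Mₙ(ℝ) is defined by ω(t)_{ij} = ((bᵢ − bⱼ)/(aᵢ − aⱼ))·x(t)_{ij} for i ≠ j and ω(t)_{ii} = 0. Then for every λ ∈ ℝ and every k ∈ ℕ, the function t ↦ trace((x(t) + λ·A)^k) is constant on ℝ. -/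

import Mathlib

/-!
The Manakov functions (5.2) are first integrals of the Euler equation (5.3):
if `x : ℝ → Mₙ(ℝ)` is skew-symmetric and satisfies `x' = ⁅x, ω⁆` with
`ω_{ij} = ((bᵢ - bⱼ)/(aᵢ - aⱼ)) x_{ij}` (`i ≠ j`), `ω_{ii} = 0`, then for all
`λ ∈ ℝ` and `k ∈ ℕ` the function `t ↦ trace ((x t + λ diag a) ^ k)` is constant.
-/

open Matrix

noncomputable section

attribute [local instance] Matrix.linftyOpNormedAddCommGroup Matrix.linftyOpNormedRing
  Matrix.linftyOpNormedAlgebra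

/-- The Manakov angular velocity `ω = ad_A⁻¹ ∘ ad_B (x)`:
`ω_{ij} = ((bᵢ - bⱼ)/(aᵢ - aⱼ)) x_{ij}` for `i ≠ j`, and `ω_{ii} = 0`. -/
def manakovOmega {n : ℕ} (a b : Fin n → ℝ) (x : Matrix (Fin n) (Fin n) ℝ) :
    Matrix (Fin n) (Fin n) ℝ :=
  Matrix.of fun i j => if i = j then 0 else ((b i - b j) / (a i - a j)) * x i j

/-- The bracket is unchanged by adding multiples of commuting `A`, `B` with `⁅A, w⁆ = ⁅B, x⁆`. -/
lemma lie_add_smul_add_smul {K R : Type*} [CommRing K] [Ring R] [Algebra K R] {A B x w : R}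
    (hAB : ⁅A, w⁆ = ⁅B, x⁆) (hcomm : ⁅A, B⁆ = 0) (c : K) :
    ⁅x + c • A, w + c • B⁆ = ⁅x, w⁆ := by
  have hexpand : ⁅x + c • A, w + c • B⁆ =
      ⁅x, w⁆ + c • (⁅A, w⁆ - ⁅B, x⁆) + (c * c) • ⁅A, B⁆ := by
    simp only [Ring.lie_def, add_mul, mul_add, smul_mul_assoc, mul_smul_comm, mul_smul, smul_sub,
      smul_add]
    abel
  rw [hexpand, hAB, hcomm, sub_self, smul_zero, smul_zero, add_zero, add_zero]

/-- Adding the spectral parameter to the Euler equation: `⁅x + λA, ω + λB⁆ = ⁅x, ω⁆`. -/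
lemma lie_add_smul_diagonal_manakovOmega {n : ℕ} {a : Fin n → ℝ} (b : Fin n → ℝ)
    (ha : Function.Injective a) (x : Matrix (Fin n) (Fin n) ℝ) (lam : ℝ) :
    ⁅x + lam • Matrix.diagonal a, manakovOmega a b x + lam • Matrix.diagonal b⁆ =
      ⁅x, manakovOmega a b x⁆ := by
  have hAB : ⁅Matrix.diagonal a, manakovOmega a b x⁆ = ⁅Matrix.diagonal b, x⁆ := by
    ext i j
    simp only [Ring.lie_def, Matrix.sub_apply, Matrix.diagonal_mul, Matrix.mul_diagonal,
      manakovOmega, Matrix.of_apply]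
    split_ifs with hij
    · subst hij
      ring
    · have : a i - a j ≠ 0 := sub_ne_zero.mpr (ha.ne hij)
      field_simp
  have hdiag : ⁅Matrix.diagonal a, Matrix.diagonal b⁆ = 0 := by
    rw [Ring.lie_def, Matrix.diagonal_mul_diagonal, Matrix.diagonal_mul_diagonal]
    simp [mul_comm]
  exact lie_add_smul_add_smul hAB hdiag lam

/-- Powers of a solution of the Lax equation `L' = ⁅L, M⁆` satisfy the same equation. -/
lemma HasDerivAt.pow_of_lie {R : Type*} [NormedRing R] [NormedAlgebra ℝ R]
    {L : ℝ → R} {M : R} {t : ℝ} (h : HasDerivAt L ⁅L t, M⁆ t) (k : ℕ) :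
    HasDerivAt (fun s => L s ^ k) ⁅L t ^ k, M⁆ t := by
  induction k with
  | zero => simpa [Ring.lie_def] using hasDerivAt_const t (1 : R)
  | succ k ih =>
    simp only [pow_succ]
    refine (ih.mul h).congr_deriv ?_
    simp only [Ring.lie_def]
    noncomm_ring

theorem manakov_integrals_constant (n : ℕ) (a b : Fin n → ℝ) (ha : Function.Injective a)
    (x : ℝ → Matrix (Fin n) (Fin n) ℝ)
    (hskew : ∀ t : ℝ, (x t)ᵀ = -(x t))
    (hderiv : ∀ t : ℝ, HasDerivAt x ⁅x t, manakovOmega a b (x t)⁆ t) :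
    ∀ (lam : ℝ) (k : ℕ) (t : ℝ),
      Matrix.trace ((x t + lam • Matrix.diagonal a) ^ k) =
        Matrix.trace ((x 0 + lam • Matrix.diagonal a) ^ k) := by
  intro lam k t
  have hzero : ∀ s : ℝ,
      HasDerivAt (fun r => Matrix.trace ((x r + lam • Matrix.diagonal a) ^ k)) 0 s := by
    intro s
    have hLax := (hderiv s).add_const (lam • Matrix.diagonal a)
    rw [← lie_add_smul_diagonal_manakovOmega b ha (x s) lam] at hLax
    have htr := (LinearMap.toContinuousLinearMap
      (Matrix.traceLinearMap (Fin n) ℝ ℝ)).hasFDerivAt.comp_hasDerivAt s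
        (HasDerivAt.pow_of_lie hLax k)
    refine htr.congr_deriv ?_
    change Matrix.trace (⁅(_ : Matrix (Fin n) (Fin n) ℝ), (_ : Matrix (Fin n) (Fin n) ℝ)⁆) = 0
    rw [Ring.lie_def, Matrix.trace_sub, Matrix.trace_mul_comm, sub_self]
  exact is_const_of_deriv_eq_zero (fun s => (hzero s).differentiableAt)
    (fun s => (hzero s).deriv) t 0

end
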